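/- Let Γ be a finite connected graph on n nodes, and for each i ≥ 1 let f_{i−1} denote the number of Morse matchings on Γ of cardinality i (equivalently, the number of rooted forests of Γ with exactly i edges), with f_{−1} = 1. Then the characteristic polynomial of the Laplacian matrix of Γ satisfies σ(Γ;μ) = det(μI − Q(Γ)) = Σ_{i=0}^{n} (−1)^i f_{i−1} μ^{n−i}. -/

import Mathlib

open Finset

/-- Arc of the Hasse diagram of the simplicial complex `K`: from `g` to `f` whenever
`f ⊂ g` and `dim g = dim f + 1`. -/
def HasseArc {V : Type} [DecidableEq V] (K : Finset (Finset V)) (g f : Finset V) : Prop :=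
  g ∈ K ∧ f ∈ K ∧ f ⊂ g ∧ g.card = f.card + 1

/-- `M` is a matching: no two distinct pairs of `M` share an endpoint. -/
def IsMatchingPairs {α : Type} (M : Set (α × α)) : Prop :=
  ∀ p ∈ M, ∀ q ∈ M, p ≠ q → p.1 ≠ q.1 ∧ p.1 ≠ q.2 ∧ p.2 ≠ q.1 ∧ p.2 ≠ q.2

/-- One step of the Hasse diagram of `K` with the arcs belonging to `M` reversed. -/
def MorseStep {V : Type} [DecidableEq V] (K : Finset (Finset V))
    (M : Set (Finset V × Finset V)) (x y : Finset V) : Prop :=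
  (HasseArc K x y ∧ (x, y) ∉ M) ∨ ((y, x) ∈ M ∧ HasseArc K y x)

/-- A (discrete) Morse matching on the complex `K`: a matching in the Hasse diagram of `K`
such that reversing exactly the arcs of the matching yields a directed graph with no
directed cycle. -/
def IsMorseMatching {V : Type} [DecidableEq V] (K : Finset (Finset V))
    (M : Set (Finset V × Finset V)) : Prop :=
  (∀ p ∈ M, HasseArc K p.1 p.2) ∧ IsMatchingPairs M ∧
    ∀ s : Finset V, ¬ Relation.TransGen (MorseStep K M) s s

/-- A finite graph regarded as a one-dimensional simplicial complex: faces are the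
vertices (as singletons) and the edges (as two-element sets). -/
noncomputable def graphComplex {V : Type} [Fintype V] [DecidableEq V] (G : SimpleGraph V) :
    Finset (Finset V) := by
  classical
  exact Finset.univ.filter fun s => (∃ v, s = {v}) ∨ ∃ u v, G.Adj u v ∧ s = {u, v}

/-- The matching of the Hasse diagram attached to a partial function `φ` on the nodes: the node `v`
is matched with the edge `{v, u}` whenever `φ v = some u`. -/
def pairsOf {V : Type} [Fintype V] [DecidableEq V] (φ : V → Option V) :
    Finset (Finset V × Finset V) :=
  univ.filter fun p => ∃ v u, φ v = some u ∧ p = ({v, u}, {v})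

/-- The partial function `φ` has no directed cycle. -/
def IsAcyclicPartial {V : Type} (φ : V → Option V) : Prop :=
  ∀ v, ¬ Relation.TransGen (fun a b => φ a = some b) v v

/-- The partial function `φ` encodes a rooted forest of `G`: it moves along edges of `G` and has no
directed cycle. -/
def IsRootedForest {V : Type} (G : SimpleGraph V) (φ : V → Option V) : Prop :=
  (∀ v u, φ v = some u → G.Adj v u) ∧ IsAcyclicPartial φ

lemma pair_right_injective {V : Type} [DecidableEq V] {v u w : V} (hu : v ≠ u)
    (h : ({v, u} : Finset V) = {v, w}) : u = w := by
  have : u ∈ ({v, w} : Finset V) := h ▸ by simp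
  simpa [hu.symm] using this

section Forest

variable {V : Type} [Fintype V] [DecidableEq V]

lemma mem_pairsOf {φ : V → Option V} {p : Finset V × Finset V} :
    p ∈ pairsOf φ ↔ ∃ v u, φ v = some u ∧ p = ({v, u}, {v}) := by
  simp [pairsOf]

lemma mem_graphComplex {G : SimpleGraph V} {s : Finset V} :
    s ∈ graphComplex G ↔ (∃ v, s = {v}) ∨ ∃ u v, G.Adj u v ∧ s = {u, v} := by
  simp [graphComplex]

lemma hasseArc_graphComplex_iff {G : SimpleGraph V} {g f : Finset V} :
    HasseArc (graphComplex G) g f ↔ ∃ v u, G.Adj v u ∧ g = {v, u} ∧ f = {v} := by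
  constructor
  · rintro ⟨hg, hf, hfg, hc⟩
    rw [mem_graphComplex] at hg hf
    obtain ⟨a, rfl⟩ | ⟨a, b, hab, rfl⟩ := hg
    · obtain ⟨c, rfl⟩ | ⟨c, d, hcd, rfl⟩ := hf
      · simp at hc
      · simp [card_pair hcd.ne] at hc
    · obtain ⟨c, rfl⟩ | ⟨c, d, hcd, rfl⟩ := hf
      · have hmem : c ∈ ({a, b} : Finset V) := hfg.1 (mem_singleton_self c)
        rcases mem_insert.1 hmem with rfl | h
        · exact ⟨c, b, hab, rfl, rfl⟩
        · rw [mem_singleton] at h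
          subst h
          exact ⟨c, a, hab.symm, pair_comm _ _, rfl⟩
      · simp [card_pair hcd.ne, card_pair hab.ne] at hc
  · rintro ⟨v, u, h, rfl, rfl⟩
    refine ⟨mem_graphComplex.2 (Or.inr ⟨v, u, h, rfl⟩), mem_graphComplex.2 (Or.inl ⟨v, rfl⟩), ?_, ?_⟩
    · rw [Finset.ssubset_iff_of_subset (by simp)]
      exact ⟨u, by simp, by simpa using h.ne'⟩
    · simp [card_pair h.ne]

lemma mk_mem_pairsOf {φ : V → Option V} {v u : V} (hvu : v ≠ u) :
    (({v, u}, {v}) : Finset V × Finset V) ∈ pairsOf φ ↔ φ v = some u := by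
  rw [mem_pairsOf]
  constructor
  · rintro ⟨a, b, hab, h⟩
    obtain ⟨h1, h2⟩ := Prod.mk.inj h
    obtain rfl := singleton_injective h2
    rwa [pair_right_injective hvu h1]
  · intro h
    exact ⟨v, u, h, rfl⟩

lemma eq_of_transGen_morseStep {G : SimpleGraph V} {φ : V → Option V} {v : V} {y : Finset V}
    (h : Relation.TransGen (MorseStep (graphComplex G) ↑(pairsOf φ)) {v} y) :
    (∃ w, y = {w} ∧ Relation.TransGen (fun a b => φ a = some b) v w) ∨
      ∃ w u, G.Adj w u ∧ y = {w, u} ∧ φ w = some u ∧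
        Relation.ReflTransGen (fun a b => φ a = some b) v w := by
  have up : ∀ (w : V) (y : Finset V), Relation.ReflTransGen (fun a b => φ a = some b) v w →
      MorseStep (graphComplex G) ↑(pairsOf φ) {w} y →
      ∃ w u, G.Adj w u ∧ y = {w, u} ∧ φ w = some u ∧
        Relation.ReflTransGen (fun a b => φ a = some b) v w := by
    rintro w y hvw (⟨h, -⟩ | ⟨h, h'⟩)
    · obtain ⟨a, b, hab, h1, -⟩ := hasseArc_graphComplex_iff.1 h
      have := congrArg card h1
      simp [card_pair hab.ne] at this
    · obtain ⟨a, b, hab, rfl, h2⟩ := hasseArc_graphComplex_iff.1 h'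
      obtain rfl := singleton_injective h2
      exact ⟨w, b, hab, rfl, (mk_mem_pairsOf hab.ne).1 h, hvw⟩
  induction h with
  | single h => exact Or.inr (up v _ .refl h)
  | tail _ hstep ih =>
    obtain ⟨w, rfl, hw⟩ | ⟨w, u, hadj, rfl, hφ, hw⟩ := ih
    · exact Or.inr (up w _ hw.to_reflTransGen hstep)
    · left
      obtain ⟨h, hM⟩ | ⟨-, h⟩ := hstep
      · obtain ⟨a, b, hab, h1, rfl⟩ := hasseArc_graphComplex_iff.1 h
        have ha : a ∈ ({w, u} : Finset V) := h1 ▸ by simp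
        rcases mem_insert.1 ha with rfl | ha
        · exact absurd ((mk_mem_pairsOf hadj.ne).2 hφ) hM
        · exact ⟨u, by rw [mem_singleton.1 ha], Relation.TransGen.tail' hw hφ⟩
      · obtain ⟨a, b, hab, -, h2⟩ := hasseArc_graphComplex_iff.1 h
        have := congrArg card h2
        simp [card_pair hadj.ne] at this

/-- A directed closed walk in the modified Hasse diagram of a graph passes through a node. -/
lemma exists_transGen_singleton {G : SimpleGraph V} {M : Set (Finset V × Finset V)} {s : Finset V}
    (h : Relation.TransGen (MorseStep (graphComplex G) M) s s) :
    ∃ v, Relation.TransGen (MorseStep (graphComplex G) M) {v} {v} := by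
  obtain ⟨y, hsy, hys⟩ := Relation.TransGen.head'_iff.1 h
  have hs := hsy
  obtain ⟨hy, -⟩ | ⟨-, hy⟩ := hsy
  · obtain ⟨a, b, -, -, rfl⟩ := hasseArc_graphComplex_iff.1 hy
    exact ⟨a, Relation.TransGen.tail' hys hs⟩
  · obtain ⟨a, b, -, -, rfl⟩ := hasseArc_graphComplex_iff.1 hy
    exact ⟨a, h⟩

lemma isMorseMatching_pairsOf_iff {G : SimpleGraph V} {φ : V → Option V}
    (hφ : ∀ v u, φ v = some u → G.Adj v u) :
    IsMorseMatching (graphComplex G) ↑(pairsOf φ) ↔ IsAcyclicPartial φ := by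
  constructor
  · rintro ⟨-, hmatch, hacyc⟩ v hv
    refine hacyc {v} ?_
    refine Relation.TransGen.lift' (fun a : V => ({a} : Finset V)) (fun a b hab => ?_) _ _ hv
    have hadj := hφ a b hab
    have hmem := (mk_mem_pairsOf hadj.ne).2 hab
    refine .tail (.single (Or.inr ⟨hmem, hasseArc_graphComplex_iff.2 ⟨a, b, hadj, rfl, rfl⟩⟩))
      (Or.inl ⟨hasseArc_graphComplex_iff.2 ⟨b, a, hadj.symm, pair_comm _ _, rfl⟩, fun h => ?_⟩)
    exact (hmatch _ hmem _ h (by simpa using hadj.ne)).1 rfl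
  · intro hac
    refine ⟨?_, ?_, ?_⟩
    · intro p hp
      obtain ⟨v, u, h, rfl⟩ := mem_pairsOf.1 hp
      exact hasseArc_graphComplex_iff.2 ⟨v, u, hφ v u h, rfl, rfl⟩
    · intro p hp q hq hpq
      obtain ⟨v, u, h, rfl⟩ := mem_pairsOf.1 hp
      obtain ⟨a, b, h', rfl⟩ := mem_pairsOf.1 hq
      have hva : v ≠ a := by
        rintro rfl
        rw [h] at h'
        obtain rfl := Option.some.inj h'
        exact hpq rfl
      refine ⟨fun he => ?_, fun he => ?_, fun he => ?_, fun he => hva (singleton_injective he)⟩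
      · simp only at he
        have ha : a ∈ ({v, u} : Finset V) := he ▸ by simp
        have hv : v ∈ ({a, b} : Finset V) := he ▸ by simp
        have ha : a = u := by simpa [hva.symm] using ha
        have hv : v = b := by simpa [hva] using hv
        subst ha hv
        exact hac v (.tail (.single h) h')
      · have := congrArg card he
        simp [card_pair (hφ v u h).ne] at this
      · have := congrArg card he
        simp [card_pair (hφ a b h').ne] at this
    · intro s hs
      obtain ⟨v, hv⟩ := exists_transGen_singleton hs
      obtain ⟨w, h, hw⟩ | ⟨w, u, hadj, h, -⟩ := eq_of_transGen_morseStep hv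
      · obtain rfl := singleton_injective h
        exact hac v hw
      · have := congrArg card h
        simp [card_pair hadj.ne] at this

lemma exists_pairsOf_eq {G : SimpleGraph V} {M : Finset (Finset V × Finset V)}
    (hM : IsMorseMatching (graphComplex G) ↑M) :
    ∃ φ : V → Option V, (∀ v u, φ v = some u → G.Adj v u) ∧ pairsOf φ = M := by
  classical
  obtain ⟨harc, hmatch, -⟩ := hM
  have key : ∀ v, ∃ o : Option V, ∀ u,
      o = some u ↔ G.Adj v u ∧ (({v, u}, {v}) : Finset V × Finset V) ∈ M := by
    intro v
    by_cases h : ∃ u, G.Adj v u ∧ (({v, u}, {v}) : Finset V × Finset V) ∈ M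
    · obtain ⟨u, hadj, hu⟩ := h
      refine ⟨some u, fun w => ⟨?_, ?_⟩⟩
      · rintro h
        obtain rfl := Option.some.inj h
        exact ⟨hadj, hu⟩
      · rintro ⟨-, hw⟩
        by_contra hne
        refine (hmatch _ hu _ hw fun h => hne ?_).2.2.2 rfl
        rw [pair_right_injective hadj.ne (Prod.mk.inj h).1]
    · refine ⟨none, fun u => ⟨by simp, fun hu => (h ⟨u, hu⟩).elim⟩⟩
  choose φ hφ using key
  refine ⟨φ, fun v u h => ((hφ v u).1 h).1, ?_⟩
  ext p
  rw [mem_pairsOf]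
  constructor
  · rintro ⟨v, u, h, rfl⟩
    exact ((hφ v u).1 h).2
  · intro hp
    obtain ⟨v, u, hadj, h1, h2⟩ := hasseArc_graphComplex_iff.1 (harc p hp)
    obtain rfl : p = ({v, u}, {v}) := Prod.ext h1 h2
    exact ⟨v, u, (hφ v u).2 ⟨hadj, hp⟩, rfl⟩

lemma pairsOf_injOn (G : SimpleGraph V) :
    Set.InjOn pairsOf {φ : V → Option V | ∀ v u, φ v = some u → G.Adj v u} := by
  intro φ hφ ψ hψ h
  ext v u
  constructor
  · intro hu
    rwa [← mk_mem_pairsOf (hφ v u hu).ne, ← h, mk_mem_pairsOf (hφ v u hu).ne]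
  · intro hu
    rwa [← mk_mem_pairsOf (hψ v u hu).ne, h, mk_mem_pairsOf (hψ v u hu).ne]

lemma card_pairsOf (φ : V → Option V) :
    (pairsOf φ).card = (univ.filter fun v => (φ v).isSome).card := by
  symm
  refine card_bij (fun v _ => (insert v (φ v).toFinset, {v})) ?_ ?_ ?_
  · intro v hv
    obtain ⟨u, hu⟩ := Option.isSome_iff_exists.1 (mem_filter.1 hv).2
    exact mem_pairsOf.2 ⟨v, u, hu, by simp [hu]⟩
  · intro v _ w _ h
    exact singleton_injective (Prod.mk.inj h).2
  · intro p hp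
    obtain ⟨v, u, hu, rfl⟩ := mem_pairsOf.1 hp
    exact ⟨v, by simp [hu], by simp [hu]⟩

lemma ncard_morseMatching (G : SimpleGraph V) (i : ℕ) :
    {M : Finset (Finset V × Finset V) | IsMorseMatching (graphComplex G) ↑M ∧ M.card = i}.ncard =
      {φ : V → Option V | IsRootedForest G φ ∧
        (univ.filter fun v => (φ v).isSome).card = i}.ncard := by
  rw [← Set.InjOn.ncard_image ((pairsOf_injOn G).mono fun φ hφ => hφ.1.1)]
  congr 1
  ext M
  constructor
  · rintro ⟨hM, hi⟩
    obtain ⟨φ, hφ, rfl⟩ := exists_pairsOf_eq hM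
    exact ⟨φ, ⟨⟨hφ, (isMorseMatching_pairsOf_iff hφ).1 hM⟩, by rw [← card_pairsOf, hi]⟩, rfl⟩
  · rintro ⟨φ, ⟨⟨hφ, hac⟩, hi⟩, rfl⟩
    exact ⟨(isMorseMatching_pairsOf_iff hφ).2 hac, by rw [card_pairsOf, hi]⟩

end Forest

section Determinant

variable {V : Type} [Fintype V] [DecidableEq V] {R : Type*} [CommRing R]

/-- The row `e_v` when `o = none`, and `e_v - e_u` when `o = some u`. -/
def forestRow (R : Type*) [CommRing R] (v : V) (o : Option V) : V → R :=
  fun w => (if v = w then 1 else 0) - (if o = some w then 1 else 0)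

lemma det_forestRow_of_acyclic {φ : V → Option V} (hφ : IsAcyclicPartial φ)
    (hloop : ∀ v, φ v ≠ some v) :
    Matrix.det (Matrix.of fun v => forestRow R v (φ v)) = 1 := by
  have hwf : WellFounded (fun a b => φ a = some b) := by
    have : Std.Irrefl (Relation.TransGen (fun a b => φ a = some b)) := ⟨hφ⟩
    exact Subrelation.wf (r := Relation.TransGen (fun a b => φ a = some b))
      (fun h => Relation.TransGen.single h)
      (Finite.wellFounded_of_trans_of_irrefl (Relation.TransGen (fun a b => φ a = some b)))
  rw [Matrix.det_apply, Finset.sum_eq_single 1]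
  · simp [forestRow, hloop]
  · intro σ _ hσ
    suffices ∃ v, forestRow R (σ v) (φ (σ v)) v = 0 by
      obtain ⟨v, hv⟩ := this
      rw [Finset.prod_eq_zero (mem_univ v) (by simpa using hv), smul_zero]
    by_contra! hne
    have hmoved : {v | σ v ≠ v}.Nonempty := by
      by_contra h
      exact hσ (Equiv.ext fun v => by
        by_contra hv
        exact h ⟨v, hv⟩)
    obtain ⟨m, hm, hmin⟩ := hwf.has_min _ hmoved
    refine hmin (σ m) (fun h => hm (σ.injective h)) ?_
    by_contra h
    exact hne m (by simp [forestRow, h, show σ m ≠ m from hm])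
  · simp

lemma det_forestRow_of_not_acyclic [IsDomain R] {φ : V → Option V} (hφ : ¬ IsAcyclicPartial φ) :
    Matrix.det (Matrix.of fun v => forestRow R v (φ v)) = 0 := by
  classical
  simp only [IsAcyclicPartial, not_forall, not_not] at hφ
  obtain ⟨c, hc⟩ := hφ
  have hstep : ∀ a b, φ a = some b →
      (Relation.ReflTransGen (fun a b => φ a = some b) a c ↔
        Relation.ReflTransGen (fun a b => φ a = some b) b c) := by
    intro a b hab
    refine ⟨fun h => ?_, fun h => h.head hab⟩
    have h' : Relation.TransGen (fun a b => φ a = some b) a c := by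
      rcases Relation.reflTransGen_iff_eq_or_transGen.1 h with rfl | h
      · exact hc
      · exact h
    obtain ⟨d, had, hdc⟩ := Relation.TransGen.head'_iff.1 h'
    rw [hab] at had
    obtain rfl := Option.some.inj had
    exact hdc
  refine Matrix.exists_mulVec_eq_zero_iff.1
    ⟨fun v => if Relation.ReflTransGen (fun a b => φ a = some b) v c then 1 else 0, ?_, ?_⟩
  · intro h
    simpa [Relation.ReflTransGen.refl] using congrFun h c
  · ext v
    simp only [Matrix.mulVec, dotProduct, Matrix.of_apply, forestRow, sub_mul, ite_mul, one_mul,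
      zero_mul, Finset.sum_sub_distrib, Finset.sum_ite_eq, mem_univ, if_true, Pi.zero_apply]
    rcases hv : φ v with _ | u
    · have : ¬ Relation.ReflTransGen (fun a b => φ a = some b) v c := by
        intro h
        have h' : Relation.TransGen (fun a b => φ a = some b) v c := by
          rcases Relation.reflTransGen_iff_eq_or_transGen.1 h with rfl | h
          · exact hc
          · exact h
        obtain ⟨d, hd, -⟩ := Relation.TransGen.head'_iff.1 h'
        simp [hv] at hd
      simp [this]
    · simp [hstep v u hv]

end Determinant

section Laplacian

open Polynomial

variable {V : Type} [Fintype V]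

/-- The weight of the choice `o` at the node `v`: the variable when `v` is a root, `-1` for an edge
of `G`, and `0` otherwise. -/
noncomputable def forestWeight (G : SimpleGraph V) [DecidableRel G.Adj] (v : V) :
    Option V → ℤ[X]
  | none => X
  | some u => if G.Adj v u then -1 else 0

lemma prod_forestWeight (G : SimpleGraph V) [DecidableRel G.Adj] {φ : V → Option V}
    (hφ : ∀ v u, φ v = some u → G.Adj v u) :
    ∏ v, forestWeight G v (φ v) =
      (-1) ^ (univ.filter fun v => (φ v).isSome).card *
        X ^ (Fintype.card V - (univ.filter fun v => (φ v).isSome).card) := by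
  have : ∀ v, forestWeight G v (φ v) = if (φ v).isSome then -1 else X := by
    intro v
    rcases h : φ v with _ | u
    · simp [forestWeight]
    · simp [forestWeight, hφ v u h]
  rw [Finset.prod_congr rfl fun v _ => this v, Finset.prod_ite, Finset.prod_const,
    Finset.prod_const, ← Finset.card_univ,
    ← Finset.card_filter_add_card_filter_not (s := univ) (fun v => ((φ v).isSome : Prop)),
    Nat.add_sub_cancel_left]

variable [DecidableEq V]

lemma charmatrix_lapMatrix_row (G : SimpleGraph V) [DecidableRel G.Adj] (v : V) :
    (G.lapMatrix ℤ).charmatrix v = ∑ o : Option V, forestWeight G v o • forestRow ℤ[X] v o := by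
  ext1 w
  simp only [Finset.sum_apply, Pi.smul_apply, smul_eq_mul, Fintype.sum_option, forestWeight,
    forestRow, mul_sub, Finset.sum_sub_distrib,
    mul_ite, mul_one, mul_zero, Finset.sum_ite_eq', mem_univ, if_true, Matrix.charmatrix_apply,
    SimpleGraph.lapMatrix, SimpleGraph.degMatrix, Matrix.sub_apply, Matrix.diagonal_apply,
    SimpleGraph.adjMatrix_apply]
  by_cases h : v = w
  · subst h
    simp [SimpleGraph.degree_eq_sum_if_adj, Finset.sum_ite, sub_eq_add_neg]
  · simp [h, apply_ite]

open Classical in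
lemma charpoly_lapMatrix_eq_sum_forest (G : SimpleGraph V) [DecidableRel G.Adj] :
    (G.lapMatrix ℤ).charpoly =
      ∑ φ : V → Option V with IsRootedForest G φ,
        (-1) ^ (univ.filter fun v => (φ v).isSome).card *
          X ^ (Fintype.card V - (univ.filter fun v => (φ v).isSome).card) := by
  have hrows : (G.lapMatrix ℤ).charmatrix =
      fun v => ∑ o : Option V, forestWeight G v o • forestRow ℤ[X] v o :=
    funext (charmatrix_lapMatrix_row G)
  have hexpand : (G.lapMatrix ℤ).charpoly = ∑ φ : V → Option V,
      (∏ v, forestWeight G v (φ v)) *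
        Matrix.det (Matrix.of fun v => forestRow ℤ[X] v (φ v)) := by
    rw [Matrix.charpoly, hrows]
    refine (Matrix.detRowAlternating.toMultilinearMap.map_sum
      (fun v (o : Option V) => forestWeight G v o • forestRow ℤ[X] v o)).trans ?_
    refine Finset.sum_congr rfl fun φ _ => ?_
    exact Matrix.detRowAlternating.toMultilinearMap.map_smul_univ
      (fun v => forestWeight G v (φ v)) (fun v => forestRow ℤ[X] v (φ v))
  rw [hexpand, Finset.sum_filter]
  refine Finset.sum_congr rfl fun φ _ => ?_
  split_ifs with h
  · rw [prod_forestWeight G h.1,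
      det_forestRow_of_acyclic h.2 (fun v hv => (h.1 v v hv).ne rfl), mul_one]
  · by_cases hφ : ∀ v u, φ v = some u → G.Adj v u
    · rw [det_forestRow_of_not_acyclic fun hac => h ⟨hφ, hac⟩, mul_zero]
    · push Not at hφ
      obtain ⟨v, u, hvu, hadj⟩ := hφ
      rw [Finset.prod_eq_zero (mem_univ v) (by simp [hvu, forestWeight, hadj]), zero_mul]

end Laplacian

/-- for a finite connected graph `Γ` on `n` nodes, the characteristic
polynomial `det (μ I - Q(Γ))` of the Laplacian matrix equals
`∑_{i=0}^{n} (-1)^i f_{i-1} μ^{n-i}`, where `f_{i-1}` is the number of Morse matchings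
on `Γ` of cardinality `i` (so that `f_{-1} = 1`, the empty matching being the unique
Morse matching of cardinality `0`). -/
theorem lap_charpoly_eq_morse_generating_polynomial (n : ℕ) (G : SimpleGraph (Fin n))
    [DecidableRel G.Adj] (hconn : G.Connected) :
    (G.lapMatrix ℤ).charpoly =
      ∑ i ∈ Finset.range (n + 1),
        Polynomial.C ((-1 : ℤ) ^ i *
          ({M : Finset (Finset (Fin n) × Finset (Fin n)) |
              IsMorseMatching (graphComplex G) ↑M ∧ M.card = i}.ncard : ℤ)) *
          Polynomial.X ^ (n - i) := by
  classical
  rw [charpoly_lapMatrix_eq_sum_forest, Fintype.card_fin,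
    ← Finset.sum_fiberwise_of_maps_to (t := Finset.range (n + 1))
      (g := fun φ : Fin n → Option (Fin n) => (univ.filter fun v => (φ v).isSome).card)
      (fun φ _ => Finset.mem_range.2 (Nat.lt_succ_of_le ((card_le_univ _).trans_eq (by simp))))]
  refine Finset.sum_congr rfl fun i _ => ?_
  rw [ncard_morseMatching, Finset.filter_filter, Finset.sum_congr rfl
    (g := fun _ => (-1 : Polynomial ℤ) ^ i * Polynomial.X ^ (n - i))
    (fun φ hφ => by rw [(mem_filter.1 hφ).2.2]), Finset.sum_const, Set.ncard_eq_toFinset_card',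
    Set.toFinset_ofPred, nsmul_eq_mul]
  simp only [Polynomial.C_mul, Polynomial.C_pow, Polynomial.C_neg, Polynomial.C_1,
    map_natCast]
  ring
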